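/- arXiv:2507.04544 — 3 statements merged into one kernel-verified Lean document; each statement's English description precedes it below -/
import Mathlib

section
/- Let f be holomorphic on the open unit disk 𝔻 with |f(z)| ≤ 1 for all z ∈ 𝔻, and let a_k be its Taylor coefficients at 0. If m, n are nonnegative integers with n − m = 2, then sup_{z ∈ 𝔻} |∑_{k=m}^n a_k z^k| < 1/3 + 2√3/π. -/
open Finset Metric

lemma one_add_two_mul_cos_pos_of_lt {t : ℝ} (h0 : 0 ≤ t) (h : t < 2 * Real.pi / 3) :
    0 < 1 + 2 * Real.cos t := by
  have h1 : Real.cos (Real.pi - Real.pi / 3) < Real.cos t :=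
    Real.cos_lt_cos_of_nonneg_of_le_pi h0 (by linarith [Real.pi_pos]) (by linarith)
  rw [Real.cos_pi_sub, Real.cos_pi_div_three] at h1
  linarith

lemma one_add_two_mul_cos_neg {t : ℝ} (h1 : 2 * Real.pi / 3 < t) (h2 : t < 4 * Real.pi / 3) :
    1 + 2 * Real.cos t < 0 := by
  have h : Real.cos (Real.pi / 3) < Real.cos |t - Real.pi| :=
    Real.cos_lt_cos_of_nonneg_of_le_pi (abs_nonneg _) (by linarith [Real.pi_pos])
      (by rw [abs_lt]; constructor <;> linarith)
  rw [Real.cos_abs, Real.cos_sub_pi, Real.cos_pi_div_three] at h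
  linarith

lemma one_add_two_mul_cos_pos_of_gt {t : ℝ} (h1 : 4 * Real.pi / 3 < t) (h2 : t ≤ 2 * Real.pi) :
    0 < 1 + 2 * Real.cos t := by
  rw [← Real.cos_two_pi_sub]
  exact one_add_two_mul_cos_pos_of_lt (by linarith) (by linarith)

lemma measurable_sign_mul {h : ℝ → ℝ} (hh : Continuous h) :
    Measurable fun t => (1 + 2 * Real.cos t) / |1 + 2 * Real.cos t| * h t := by
  fun_prop

lemma integral_sign_mul {h : ℝ → ℝ} (hh : Continuous h) :
    ∫ t in (0 : ℝ)..2 * Real.pi, (1 + 2 * Real.cos t) / |1 + 2 * Real.cos t| * h t =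
      (∫ t in (0 : ℝ)..2 * Real.pi / 3, h t) -
      (∫ t in 2 * Real.pi / 3..4 * Real.pi / 3, h t) +
      ∫ t in 4 * Real.pi / 3..2 * Real.pi, h t := by
  have hpi := Real.pi_pos
  have hint : ∀ a b : ℝ, IntervalIntegrable
      (fun t => (1 + 2 * Real.cos t) / |1 + 2 * Real.cos t| * h t) MeasureTheory.volume a b := by
    intro a b
    refine (hh.intervalIntegrable a b).mono_fun (measurable_sign_mul hh).aestronglyMeasurable ?_
    refine Filter.Eventually.of_forall fun t => ?_
    beta_reduce
    rw [norm_mul, norm_div, Real.norm_eq_abs, Real.norm_eq_abs |_|, abs_abs]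
    exact mul_le_of_le_one_left (norm_nonneg _) (div_self_le_one _)
  rw [← intervalIntegral.integral_add_adjacent_intervals (hint 0 (4 * Real.pi / 3)) (hint _ _),
    ← intervalIntegral.integral_add_adjacent_intervals (hint 0 (2 * Real.pi / 3)) (hint _ _),
    sub_eq_add_neg, ← intervalIntegral.integral_neg]
  congr 1
  · congr 1
    · refine intervalIntegral.integral_congr_Ioo_of_le (by linarith) fun t ht => ?_
      have := one_add_two_mul_cos_pos_of_lt ht.1.le ht.2
      simp only [abs_of_pos this, div_self this.ne', one_mul]
    · refine intervalIntegral.integral_congr_Ioo_of_le (by linarith) fun t ht => ?_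
      have := one_add_two_mul_cos_neg ht.1 ht.2
      simp only [abs_of_neg this, div_neg, div_self this.ne, neg_mul, one_mul]
  · refine intervalIntegral.integral_congr_Ioo_of_le (by linarith) fun t ht => ?_
    have := one_add_two_mul_cos_pos_of_gt ht.1 ht.2.le
    simp only [abs_of_pos this, div_self this.ne', one_mul]

lemma sin_two_pi_div_three : Real.sin (2 * Real.pi / 3) = Real.sqrt 3 / 2 := by
  rw [show 2 * Real.pi / 3 = Real.pi - Real.pi / 3 by ring, Real.sin_pi_sub,
    Real.sin_pi_div_three]

lemma sin_four_pi_div_three : Real.sin (4 * Real.pi / 3) = -(Real.sqrt 3 / 2) := by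
  rw [show 4 * Real.pi / 3 = Real.pi / 3 + Real.pi by ring, Real.sin_add_pi,
    Real.sin_pi_div_three]

/-- The Lebesgue constant of the three-term Dirichlet kernel. -/
lemma integral_abs_one_add_two_mul_cos :
    ∫ t in (0 : ℝ)..2 * Real.pi, |1 + 2 * Real.cos t| =
      2 * Real.pi * (1 / 3 + 2 * Real.sqrt 3 / Real.pi) := by
  have h : ∀ a b : ℝ, ∫ t in a..b, (1 + 2 * Real.cos t) =
      (b - a) + 2 * (Real.sin b - Real.sin a) := by
    intro a b
    rw [intervalIntegral.integral_add (by simp)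
      (Continuous.intervalIntegrable (by fun_prop) _ _)]
    simp
  have h2 := integral_sign_mul (h := fun t => 1 + 2 * Real.cos t) (by fun_prop)
  have h3 : ∀ x : ℝ, x / |x| * x = |x| := by
    intro x
    rw [div_mul_eq_mul_div, ← abs_mul_abs_self, mul_self_div_self]
  simp only [h3, h, sin_two_pi_div_three, sin_four_pi_div_three, Real.sin_zero,
    Real.sin_two_pi] at h2
  rw [h2]
  field_simp
  ring

lemma integral_sign_mul_cos_ne_zero (m : ℕ) :
    ∫ t in (0 : ℝ)..2 * Real.pi, (1 + 2 * Real.cos t) / |1 + 2 * Real.cos t| *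
      Real.cos ((3 * m + 4 : ℕ) * t) ≠ 0 := by
  have hN : (((3 * m + 4 : ℕ)) : ℝ) ≠ 0 := by positivity
  have h : ∀ a b : ℝ, ∫ t in a..b, Real.cos ((3 * m + 4 : ℕ) * t) =
      ((3 * m + 4 : ℕ) : ℝ)⁻¹ *
        (Real.sin ((3 * m + 4 : ℕ) * b) - Real.sin ((3 * m + 4 : ℕ) * a)) := by
    intro a b
    rw [intervalIntegral.integral_comp_mul_left _ hN]
    simp
  rw [integral_sign_mul (by fun_prop)]
  simp only [h]
  have e1 : Real.sin ((3 * m + 4 : ℕ) * (2 * Real.pi / 3)) = Real.sqrt 3 / 2 := by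
    rw [← sin_two_pi_div_three, ← Real.sin_add_nat_mul_two_pi (2 * Real.pi / 3) (m + 1)]
    congr 1
    push_cast
    ring
  have e2 : Real.sin ((3 * m + 4 : ℕ) * (4 * Real.pi / 3)) = -(Real.sqrt 3 / 2) := by
    rw [← sin_four_pi_div_three,
      ← Real.sin_add_nat_mul_two_pi (4 * Real.pi / 3) (2 * (m + 1))]
    congr 1
    push_cast
    ring
  have e3 : Real.sin ((3 * m + 4 : ℕ) * (2 * Real.pi)) = 0 := by
    rw [← Real.sin_zero, ← Real.sin_add_nat_mul_two_pi 0 (3 * m + 4), zero_add]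
  rw [e1, e2, e3, mul_zero, Real.sin_zero]
  have h3 : (0 : ℝ) < Real.sqrt 3 := by positivity
  have hN' : (0 : ℝ) < ((3 * m + 4 : ℕ) : ℝ)⁻¹ := by positivity
  have := mul_pos hN' h3
  apply ne_of_gt
  linarith

/-- The `L¹` norm of the Dirichlet kernel is strictly decreased by a suitable perturbation of
frequency `3 * m + 4`. -/
lemma exists_integral_norm_lt (m : ℕ) : ∃ ε : ℝ,
    ∫ t in (0 : ℝ)..2 * Real.pi,
      ‖((1 + 2 * Real.cos t : ℝ) : ℂ) + ε * circleMap 0 1 t ^ (3 * m + 4)‖ <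
      ∫ t in (0 : ℝ)..2 * Real.pi, |1 + 2 * Real.cos t| := by
  by_contra! hmin
  have hderiv : HasDerivAt (fun ε : ℝ => ∫ t in (0 : ℝ)..2 * Real.pi,
      ‖((1 + 2 * Real.cos t : ℝ) : ℂ) + ε * circleMap 0 1 t ^ (3 * m + 4)‖)
      (∫ t in (0 : ℝ)..2 * Real.pi, (1 + 2 * Real.cos t) / |1 + 2 * Real.cos t| *
        Real.cos ((3 * m + 4 : ℕ) * t)) 0 := by
    have hcont : ∀ ε : ℝ, Continuous fun t : ℝ =>
        ‖((1 + 2 * Real.cos t : ℝ) : ℂ) + ε * circleMap 0 1 t ^ (3 * m + 4)‖ := by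
      intro ε
      fun_prop
    refine (intervalIntegral.hasDerivAt_integral_of_dominated_loc_of_lip (s := Set.univ)
      (bound := fun _ => 1) Filter.univ_mem
      (Filter.Eventually.of_forall fun ε => (hcont ε).aestronglyMeasurable)
      ((hcont 0).intervalIntegrable _ _)
      (measurable_sign_mul (by fun_prop)).aestronglyMeasurable
      (Filter.Eventually.of_forall fun t _ => ?_) (by simp) ?_).2
    · refine LipschitzWith.lipschitzOnWith (LipschitzWith.of_dist_le_mul fun x y => ?_)
      have hle := abs_norm_sub_norm_le
        (((1 + 2 * Real.cos t : ℝ) : ℂ) + x * circleMap 0 1 t ^ (3 * m + 4))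
        (((1 + 2 * Real.cos t : ℝ) : ℂ) + y * circleMap 0 1 t ^ (3 * m + 4))
      rw [add_sub_add_left_eq_sub, ← sub_mul, ← Complex.ofReal_sub, norm_mul, norm_pow,
        norm_circleMap_zero, Complex.norm_real] at hle
      simpa [Real.dist_eq] using hle
    · filter_upwards [(Set.toFinite {2 * Real.pi / 3, 4 * Real.pi / 3}).countable.ae_notMem
        MeasureTheory.volume] with t ht hmem
      rw [Set.uIoc_of_le (by positivity)] at hmem
      simp only [Set.mem_insert_iff, Set.mem_singleton_iff, not_or] at ht
      have hK : 1 + 2 * Real.cos t ≠ 0 := by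
        rcases lt_or_gt_of_ne ht.1 with h | h
        · exact (one_add_two_mul_cos_pos_of_lt hmem.1.le h).ne'
        rcases lt_or_gt_of_ne ht.2 with h' | h'
        · exact (one_add_two_mul_cos_neg h h').ne
        · exact (one_add_two_mul_cos_pos_of_gt h' hmem.2).ne'
      set N := 3 * m + 4
      set K := 1 + 2 * Real.cos t
      have hexp : circleMap 0 1 t ^ N = ⟨Real.cos (N * t), Real.sin (N * t)⟩ := by
        rw [circleMap_zero, Complex.ofReal_one, one_mul, ← Complex.exp_nat_mul,
          ← mul_assoc, ← Complex.ofReal_natCast, ← Complex.ofReal_mul, Complex.exp_mul_I,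
          ← Complex.ofReal_cos, ← Complex.ofReal_sin, Complex.mk_eq_add_mul_I]
      have hform : (fun x : ℝ => ‖(K : ℂ) + x * circleMap 0 1 t ^ N‖) = fun x : ℝ =>
          Real.sqrt ((K + x * Real.cos (N * t)) ^ 2 + (x * Real.sin (N * t)) ^ 2) := by
        funext x
        rw [Complex.norm_eq_sqrt_sq_add_sq, hexp]
        simp
      rw [hform]
      have hd : HasDerivAt (fun x : ℝ =>
          (K + x * Real.cos (N * t)) ^ 2 + (x * Real.sin (N * t)) ^ 2)
          (2 * K * Real.cos (N * t)) 0 := by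
        have h1 := ((((hasDerivAt_id (0 : ℝ)).mul_const (Real.cos (N * t))).const_add K).pow 2).add
          (((hasDerivAt_id (0 : ℝ)).mul_const (Real.sin (N * t))).pow 2)
        exact h1.congr_deriv (by simp)
      refine (hd.sqrt (by simpa using hK)).congr_deriv ?_
      simp only [zero_mul, add_zero, ne_eq, OfNat.ofNat_ne_zero, not_false_eq_true, zero_pow,
        Real.sqrt_sq_eq_abs]
      field_simp
  refine integral_sign_mul_cos_ne_zero m (IsLocalMin.hasDerivAt_eq_zero ?_ hderiv)
  refine Filter.Eventually.of_forall fun ε => ?_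
  simpa only [Complex.ofReal_zero, zero_mul, add_zero, Complex.norm_real, Real.norm_eq_abs]
    using hmin ε

/-- The Cauchy integral formula for Taylor coefficients over the unit circle. -/
lemma coeff_eq_integral {g : ℂ → ℂ} {b : ℕ → ℂ}
    (hg : DifferentiableOn ℂ g (closedBall 0 1))
    (hb : ∀ᶠ z : ℂ in nhds 0, HasSum (fun k : ℕ => b k * z ^ k) (g z)) (k : ℕ) :
    ∫ θ in (0 : ℝ)..2 * Real.pi, (circleMap 0 1 θ)⁻¹ ^ k * g (circleMap 0 1 θ) =
      2 * Real.pi * b k := by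
  have h1 : HasFPowerSeriesAt g (FormalMultilinearSeries.ofScalars ℂ b) 0 := by
    rw [hasFPowerSeriesAt_iff]
    filter_upwards [hb] with z hz
    simpa [FormalMultilinearSeries.coeff_ofScalars, mul_comm] using hz
  have h2 : HasFPowerSeriesAt g (cauchyPowerSeries g 0 1) 0 :=
    (DifferentiableOn.hasFPowerSeriesOnBall (R := 1) (by simpa using hg) one_pos).hasFPowerSeriesAt
  have h3 := congrArg (fun p : FormalMultilinearSeries ℂ ℂ ℂ => p k (fun _ => 1))
    (h1.eq_formalMultilinearSeries h2)
  simp only [cauchyPowerSeries_apply, circleIntegral, deriv_circleMap] at h3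
  have h4 : ∀ θ : ℝ, (circleMap 0 1 θ * Complex.I) • ((1 / (circleMap 0 1 θ - 0)) ^ k •
      (circleMap 0 1 θ - 0)⁻¹ • g (circleMap 0 1 θ)) =
      Complex.I * ((circleMap 0 1 θ)⁻¹ ^ k * g (circleMap 0 1 θ)) := by
    intro θ
    have : circleMap 0 1 θ ≠ 0 := circleMap_ne_center one_ne_zero
    simp only [smul_eq_mul, sub_zero, one_div]
    field_simp
  simp only [h4, intervalIntegral.integral_const_mul] at h3
  have h5 : (FormalMultilinearSeries.ofScalars ℂ b k) (fun _ : Fin k => (1 : ℂ)) = b k := by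
    simp [FormalMultilinearSeries.ofScalars]
  rw [h5] at h3
  rw [h3, smul_eq_mul]
  have : (Real.pi : ℂ) ≠ 0 := by exact_mod_cast Real.pi_ne_zero
  field_simp

lemma integral_pow_mul_eq_zero {g : ℂ → ℂ}
    (hg : DifferentiableOn ℂ g (closedBall 0 1)) (j : ℕ) :
    ∫ θ in (0 : ℝ)..2 * Real.pi, (circleMap 0 1 θ) ^ (j + 1) * g (circleMap 0 1 θ) = 0 := by
  have h : ∮ z in C(0, 1), z ^ j * g z = 0 := by
    apply DiffContOnCl.circleIntegral_eq_zero zero_le_one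
    apply DifferentiableOn.diffContOnCl
    rw [closure_ball _ one_ne_zero]
    exact (differentiableOn_pow j).mul hg
  simp only [circleIntegral, deriv_circleMap] at h
  have h4 : ∀ θ : ℝ, (circleMap 0 1 θ * Complex.I) •
      ((circleMap 0 1 θ) ^ j * g (circleMap 0 1 θ)) =
      Complex.I * ((circleMap 0 1 θ) ^ (j + 1) * g (circleMap 0 1 θ)) := by
    intro θ
    simp only [smul_eq_mul]
    ring
  simpa only [h4, intervalIntegral.integral_const_mul, mul_eq_zero, Complex.I_ne_zero,
    false_or] using h

/-- Adding a term of positive frequency to the Dirichlet kernel does not change the functional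
`b m + b (m + 1) + b (m + 2)`, so each such perturbed kernel gives a bound for it. -/
lemma norm_three_coeff_le {g : ℂ → ℂ} {b : ℕ → ℂ}
    (hg : DifferentiableOn ℂ g (closedBall 0 1)) (hg1 : ∀ z ∈ closedBall (0 : ℂ) 1, ‖g z‖ ≤ 1)
    (hb : ∀ᶠ z : ℂ in nhds 0, HasSum (fun k : ℕ => b k * z ^ k) (g z)) (m : ℕ) (ε : ℝ) :
    2 * Real.pi * ‖b m + b (m + 1) + b (m + 2)‖ ≤ ∫ t in (0 : ℝ)..2 * Real.pi,
      ‖((1 + 2 * Real.cos t : ℝ) : ℂ) + ε * circleMap 0 1 t ^ (3 * m + 4)‖ := by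
  have hmem : ∀ t : ℝ, circleMap 0 1 t ∈ closedBall (0 : ℂ) 1 := fun t =>
    circleMap_mem_closedBall 0 zero_le_one t
  have hgc : Continuous fun t : ℝ => g (circleMap 0 1 t) :=
    hg.continuousOn.comp_continuous (continuous_circleMap 0 1) hmem
  have hne : ∀ t : ℝ, circleMap 0 1 t ≠ 0 := fun t => circleMap_ne_center one_ne_zero
  have hint : ∀ k : ℕ, IntervalIntegrable
      (fun t : ℝ => (circleMap 0 1 t)⁻¹ ^ k * g (circleMap 0 1 t)) MeasureTheory.volume
      0 (2 * Real.pi) := fun k =>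
    ((((continuous_circleMap 0 1).inv₀ hne).pow k).mul hgc).intervalIntegrable _ _
  have hint' : IntervalIntegrable
      (fun t : ℝ => (ε : ℂ) * (circleMap 0 1 t ^ (2 * m + 2 + 1) * g (circleMap 0 1 t)))
      MeasureTheory.volume 0 (2 * Real.pi) :=
    ((((continuous_circleMap 0 1).pow _).mul hgc).const_mul _).intervalIntegrable _ _
  have hkernel : ∀ t : ℝ, (circleMap 0 1 t)⁻¹ ^ m * g (circleMap 0 1 t) +
      (circleMap 0 1 t)⁻¹ ^ (m + 1) * g (circleMap 0 1 t) +
      (circleMap 0 1 t)⁻¹ ^ (m + 2) * g (circleMap 0 1 t) +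
      ε * (circleMap 0 1 t ^ (2 * m + 2 + 1) * g (circleMap 0 1 t)) =
      g (circleMap 0 1 t) * (circleMap 0 1 t)⁻¹ ^ (m + 1) *
        (((1 + 2 * Real.cos t : ℝ) : ℂ) + ε * circleMap 0 1 t ^ (3 * m + 4)) := by
    intro t
    have hcos : ((1 + 2 * Real.cos t : ℝ) : ℂ) =
        1 + circleMap 0 1 t + (circleMap 0 1 t)⁻¹ := by
      rw [circleMap_zero, Complex.ofReal_one, one_mul, ← Complex.exp_neg]
      push_cast
      rw [Complex.two_cos, neg_mul]
      ring
    rw [hcos]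
    have hpow : circleMap 0 1 t ^ (3 * m + 4) =
        circleMap 0 1 t ^ (m + 1) * circleMap 0 1 t ^ (2 * m + 2 + 1) := by
      rw [← pow_add]
      congr 1
      ring
    have hcancel : (circleMap 0 1 t)⁻¹ ^ (m + 1) * circleMap 0 1 t ^ (m + 1) = 1 := by
      rw [← mul_pow, inv_mul_cancel₀ (hne t), one_pow]
    have hcancel' : (circleMap 0 1 t)⁻¹ ^ (m + 1) * circleMap 0 1 t =
        (circleMap 0 1 t)⁻¹ ^ m := by
      rw [pow_succ, mul_assoc, inv_mul_cancel₀ (hne t), mul_one]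
    rw [hpow]
    linear_combination
      (-ε * circleMap 0 1 t ^ (2 * m + 2 + 1) * g (circleMap 0 1 t)) * hcancel -
        g (circleMap 0 1 t) * hcancel'
  have hsum : (2 * Real.pi : ℂ) * (b m + b (m + 1) + b (m + 2)) =
      ∫ t in (0 : ℝ)..2 * Real.pi, g (circleMap 0 1 t) * (circleMap 0 1 t)⁻¹ ^ (m + 1) *
        (((1 + 2 * Real.cos t : ℝ) : ℂ) + ε * circleMap 0 1 t ^ (3 * m + 4)) := by
    simp only [← hkernel]
    rw [intervalIntegral.integral_add (((hint m).add (hint (m + 1))).add (hint (m + 2))) hint',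
      intervalIntegral.integral_add ((hint m).add (hint (m + 1))) (hint (m + 2)),
      intervalIntegral.integral_add (hint m) (hint (m + 1)),
      intervalIntegral.integral_const_mul, integral_pow_mul_eq_zero hg,
      coeff_eq_integral hg hb, coeff_eq_integral hg hb, coeff_eq_integral hg hb]
    ring
  have hnorm : 2 * Real.pi * ‖b m + b (m + 1) + b (m + 2)‖ =
      ‖(2 * Real.pi : ℂ) * (b m + b (m + 1) + b (m + 2))‖ := by
    simp [abs_of_pos Real.pi_pos]
  rw [hnorm, hsum]
  refine intervalIntegral.norm_integral_le_of_norm_le (by positivity)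
    (Filter.Eventually.of_forall fun t _ => ?_)
    (Continuous.intervalIntegrable (by fun_prop) _ _)
  rw [norm_mul, norm_mul, norm_pow, norm_inv, norm_circleMap_zero, abs_one, inv_one, one_pow,
    mul_one]
  exact mul_le_of_le_one_left (norm_nonneg _) (hg1 _ (hmem t))

/-- If `f` is holomorphic on the open unit disk with `|f| ≤ 1` and
`a` are its Taylor coefficients at `0`, then for nonnegative integers `m, n` with
`n - m = 2`, `sup_{z ∈ 𝔻} |∑_{k=m}^n a_k z^k| < 1/3 + 2√3/π`. -/
theorem three_term_segment_sup_lt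
    (f : ℂ → ℂ) (a : ℕ → ℂ)
    (hf : DifferentiableOn ℂ f (ball (0 : ℂ) 1))
    (hf1 : ∀ z ∈ ball (0 : ℂ) 1, ‖f z‖ ≤ 1)
    (ha : ∀ᶠ z : ℂ in nhds 0, HasSum (fun k : ℕ => a k * z ^ k) (f z))
    (m n : ℕ) (hmn : n = m + 2) :
    (⨆ z : ball (0 : ℂ) 1, ‖∑ k ∈ Finset.Icc m n, a k * (z : ℂ) ^ k‖) <
      1 / 3 + 2 * Real.sqrt 3 / Real.pi := by
  obtain ⟨ε, hε⟩ := exists_integral_norm_lt m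
  rw [integral_abs_one_add_two_mul_cos, ← div_lt_iff₀' Real.two_pi_pos] at hε
  have : Nonempty (ball (0 : ℂ) 1) := ⟨⟨0, mem_ball_self one_pos⟩⟩
  refine (ciSup_le fun z => ?_).trans_lt hε
  obtain ⟨z, hz⟩ := z
  have hmaps : Set.MapsTo (fun u : ℂ => z * u) (closedBall 0 1) (ball 0 1) := by
    intro u hu
    rw [mem_ball_zero_iff] at hz ⊢
    rw [mem_closedBall_zero_iff] at hu
    rw [norm_mul]
    exact (mul_le_of_le_one_right (norm_nonneg z) hu).trans_lt hz
  have hb : ∀ᶠ u : ℂ in nhds 0, HasSum (fun k : ℕ => a k * z ^ k * u ^ k) (f (z * u)) := by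
    have ht : Filter.Tendsto (fun u : ℂ => z * u) (nhds 0) (nhds 0) := by
      simpa using (continuous_const_mul z).tendsto 0
    filter_upwards [ht.eventually ha] with u hu
    simpa only [mul_pow, mul_assoc] using hu
  have hle := norm_three_coeff_le (g := fun u => f (z * u)) (b := fun k => a k * z ^ k)
    (hf.comp (by fun_prop) hmaps) (fun u hu => hf1 _ (hmaps hu)) hb m ε
  rw [le_div_iff₀' Real.two_pi_pos]
  subst hmn
  rw [Finset.sum_Icc_succ_top (by omega), Finset.sum_Icc_succ_top (by omega), Finset.Icc_self,
    Finset.sum_singleton]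
  exact hle
end

section
/- For n ≥ 2, let f(z) = T_n*(z)/T_n(z), where T_n*(z) = ∑_{k=0}^n b_{n-k} z^k is the conjugate-reciprocal polynomial of T_n (the coefficients b_k are real). Then |f(z)| ≤ 1 for all z in the open unit disk 𝔻, and its Taylor coefficients a_k satisfy sup_{z ∈ 𝔻} |a_{n-2} z^{n-2} + a_{n-1} z^{n-1} + a_n z^n| = ∑_{k=0}^n b_k². -/
open Finset Metric

/-- The Taylor coefficients of `√(1 - z)` at `0`. -/
noncomputable def sqrtOneSubCoeff : ℕ → ℝ
  | 0 => 1
  | m + 1 => sqrtOneSubCoeff m * (m - 1 / 2) / (m + 1)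

local notation "e" => sqrtOneSubCoeff

theorem sqrtOneSubCoeff_zero : e 0 = 1 := rfl

theorem sqrtOneSubCoeff_succ (m : ℕ) : (m + 1) * e (m + 1) = (m - 1 / 2) * e m := by
  have : (m : ℝ) + 1 ≠ 0 := by positivity
  rw [sqrtOneSubCoeff]
  field_simp

theorem sqrtOneSubCoeff_one : e 1 = -1 / 2 := by
  have := sqrtOneSubCoeff_succ 0
  norm_num [sqrtOneSubCoeff_zero] at this
  linarith

theorem sqrtOneSubCoeff_neg (m : ℕ) : e (m + 1) < 0 := by
  induction m with
  | zero => norm_num [sqrtOneSubCoeff_one]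
  | succ m ih =>
    rw [sqrtOneSubCoeff]
    apply div_neg_of_neg_of_pos _ (by positivity)
    apply mul_neg_of_neg_of_pos ih
    push_cast
    linarith [(Nat.cast_nonneg m : (0 : ℝ) ≤ m)]

theorem sum_sqrtOneSubCoeff (N : ℕ) :
    ∑ i ∈ range (N + 1), e i = -2 * (N + 1) * e (N + 1) := by
  induction N with
  | zero => norm_num [sqrtOneSubCoeff_one, sqrtOneSubCoeff_zero]
  | succ N ih =>
    rw [sum_range_succ, ih]
    have := sqrtOneSubCoeff_succ (N + 1)
    push_cast at this ⊢
    linarith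

theorem sum_sqrtOneSubCoeff_pos (N : ℕ) : 0 < ∑ i ∈ range (N + 1), e i := by
  rw [sum_sqrtOneSubCoeff]
  nlinarith [sqrtOneSubCoeff_neg N, (Nat.cast_nonneg N : (0 : ℝ) ≤ N)]

/-- The three-term recurrence of the Taylor coefficients of `√(1 + z + z²)`. -/
structure IsSqrtCoeff (b : ℕ → ℝ) : Prop where
  zero : b 0 = 1
  one : b 1 = 1 / 2
  recurrence : ∀ k : ℕ, (k + 2) * b (k + 2) = -(k + 1 / 2) * b (k + 1) - (k - 1) * b k

namespace IsSqrtCoeff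

variable {b : ℕ → ℝ}

theorem two (hb : IsSqrtCoeff b) : b 2 = 3 / 8 := by
  have := hb.recurrence 0
  norm_num [hb.zero, hb.one] at this
  linarith

theorem three (hb : IsSqrtCoeff b) : b 3 = -3 / 16 := by
  have := hb.recurrence 1
  norm_num [hb.two, hb.one] at this
  linarith

theorem four (hb : IsSqrtCoeff b) : b 4 = 3 / 128 := by
  have := hb.recurrence 2
  norm_num [hb.two, hb.three] at this
  linarith

theorem bounds (hb : IsSqrtCoeff b) (i : ℕ) :
    b (3 * i + 3) < 0 ∧ 0 ≤ b (3 * i + 4) ∧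
    3 * (3 * i + 4) * b (3 * i + 4) ≤ -2 * (3 * i + 2) * b (3 * i + 3) ∧
    (6 * i + 3) * e (i + 1) ≤ 3 * (3 * i + 2) * b (3 * i + 3) := by
  induction i with
  | zero => norm_num [hb.three, hb.four, sqrtOneSubCoeff_one]
  | succ i ih =>
    obtain ⟨hp, hq, hA, hB⟩ := ih
    have r2 := hb.recurrence (3 * i + 3)
    have r3 := hb.recurrence (3 * i + 4)
    have r4 := hb.recurrence (3 * i + 5)
    have re := sqrtOneSubCoeff_succ (i + 1)
    simp only [show 3 * (i + 1) + 3 = 3 * i + 6 by ring, show 3 * (i + 1) + 4 = 3 * i + 7 by ring]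
    simp only [add_assoc, Nat.reduceAdd] at r2 r3 r4 re
    push_cast at r2 r3 r4 re ⊢
    have hx : (0 : ℝ) ≤ i := Nat.cast_nonneg i
    generalize (i : ℝ) = x at *
    generalize b (3 * i + 3) = p at *
    generalize b (3 * i + 4) = q at *
    generalize b (3 * i + 5) = s at *
    generalize b (3 * i + 6) = p' at *
    generalize b (3 * i + 7) = q' at *
    generalize e (i + 1) = d at *
    generalize e (i + 2) = d' at *
    have hp' : (3 * x + 5) * (3 * x + 6) * p' = (3 * x + 9 / 2) * (3 * x + 2) * p + 3 / 4 * q := by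
      linear_combination (3 * x + 5) * r3 - (3 * x + 9 / 2) * r2
    have hq' : (3 * x + 5) * (3 * x + 6) * ((3 * x + 7) * q') = -(3 / 4) * (3 * x + 2) * p
        + ((3 * x + 4) * (3 * x + 7 / 2) * (3 * x + 6) - 3 / 4 * (3 * x + 11 / 2)) * q := by
      linear_combination (3 * x + 5) * (3 * x + 6) * r4 - (3 * x + 11 / 2) * hp'
        - (3 * x + 4) * (3 * x + 6) * r2
    have hD : 0 < (3 * x + 5) * (3 * x + 6) := by positivity
    have hAq : 0 ≤ x * q := by positivity
    refine ⟨?_, ?_, ?_, ?_⟩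
    · have : (3 * x + 5) * (3 * x + 6) * p' < 0 := by
        nlinarith [mul_nonneg hx (neg_nonneg.2 hp.le), mul_nonneg hx (mul_nonneg hx (neg_nonneg.2 hp.le))]
      by_contra! h
      nlinarith [mul_nonneg hD.le h]
    · have : 0 ≤ (3 * x + 5) * (3 * x + 6) * ((3 * x + 7) * q') := by
        rw [hq']
        have h1 : 0 ≤ (3 * x + 2) * (-p) := mul_nonneg (by positivity) (by linarith)
        have h2 : 0 ≤ ((3 * x + 4) * (3 * x + 7 / 2) * (3 * x + 6) - 3 / 4 * (3 * x + 11 / 2)) * q := by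
          apply mul_nonneg _ hq
          ring_nf
          positivity
        linarith
      have h3 : 0 < (3 * x + 5) * (3 * x + 6) * (3 * x + 7) := by positivity
      rw [← mul_assoc] at this
      exact nonneg_of_mul_nonneg_right this h3
    · refine le_of_mul_le_mul_left ?_ hD
      have h1 : 0 ≤ (2 * (3 * x + 5) * (3 * x + 9 / 2) - 9 / 4) *
          (-2 * (3 * x + 2) * p - 3 * (3 * x + 4) * q) :=
        mul_nonneg (by ring_nf; positivity) (by linarith)
      linear_combination 3 * hq' + 2 * (3 * x + 5) * hp' + 1 / 2 * h1 + 45 / 8 * hAq + 75 / 8 * hq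
    · have h3 : 0 < 3 * x + 6 := by positivity
      refine le_of_mul_le_mul_left ?_ h3
      linear_combination (3 * x + 9 / 2) * hB + 3 * (6 * x + 9) * re - 3 * hp' + 9 / 4 * hq

theorem nonneg_three_mul_add_one (hb : IsSqrtCoeff b) (i : ℕ) : 0 ≤ b (3 * i + 1) := by
  cases i with
  | zero => norm_num [hb.one]
  | succ i => exact (hb.bounds i).2.1

theorem nonneg_three_mul_add_two (hb : IsSqrtCoeff b) (i : ℕ) : 0 ≤ b (3 * i + 2) := by
  cases i with
  | zero => norm_num [hb.two]
  | succ i =>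
    obtain ⟨hp, hq, hA, -⟩ := hb.bounds i
    have r2 := hb.recurrence (3 * i + 3)
    simp only [show 3 * (i + 1) + 2 = 3 * i + 5 by ring]
    simp only [add_assoc, Nat.reduceAdd] at r2
    push_cast at r2
    have hx : (0 : ℝ) ≤ i := Nat.cast_nonneg i
    have hxq := mul_nonneg hx hq
    have h3 : 0 < (3 * i + 5 : ℝ) := by positivity
    refine nonneg_of_mul_nonneg_right (?_ : 0 ≤ (3 * i + 5 : ℝ) * _) h3
    linarith

theorem sqrtOneSubCoeff_le (hb : IsSqrtCoeff b) (i : ℕ) : e i ≤ b (3 * i) := by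
  cases i with
  | zero => simp [hb.zero, sqrtOneSubCoeff_zero]
  | succ i =>
    obtain ⟨hp, -, -, hB⟩ := hb.bounds i
    have hx : (0 : ℝ) ≤ i := Nat.cast_nonneg i
    have he := sqrtOneSubCoeff_neg i
    by_contra! h
    rw [show 3 * (i + 1) = 3 * i + 3 by ring] at h
    nlinarith

theorem sum_sqrtOneSubCoeff_le_sum (hb : IsSqrtCoeff b) {r : ℝ} (h0 : 0 ≤ r) (h1 : r ≤ 1) (i : ℕ) :
    ∑ j ∈ range (i + 1), e j ≤ ∑ k ∈ range (3 * i + 1), b k * r ^ k := by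
  induction i with
  | zero => simp [hb.zero, sqrtOneSubCoeff_zero]
  | succ i ih =>
    rw [sum_range_succ, show 3 * (i + 1) + 1 = 3 * i + 1 + 1 + 1 + 1 by ring,
      sum_range_succ _ (3 * i + 1 + 1 + 1), sum_range_succ _ (3 * i + 1 + 1),
      sum_range_succ _ (3 * i + 1)]
    have t1 := mul_nonneg (hb.nonneg_three_mul_add_one i) (pow_nonneg h0 (3 * i + 1))
    have t2 := mul_nonneg (hb.nonneg_three_mul_add_two i) (pow_nonneg h0 (3 * i + 2))
    have t3 : e (i + 1) ≤ b (3 * i + 3) * r ^ (3 * i + 3) := by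
      have := hb.sqrtOneSubCoeff_le (i + 1)
      rw [show 3 * (i + 1) = 3 * i + 3 by ring] at this
      nlinarith [pow_le_one₀ h0 h1 (n := 3 * i + 3), (hb.bounds i).1]
    simp only [add_assoc, Nat.reduceAdd] at *
    linarith

theorem sum_pos (hb : IsSqrtCoeff b) {r : ℝ} (h0 : 0 ≤ r) (h1 : r ≤ 1) (n : ℕ) :
    0 < ∑ k ∈ range (n + 1), b k * r ^ k := by
  have key (i : ℕ) := (sum_sqrtOneSubCoeff_pos i).trans_le (hb.sum_sqrtOneSubCoeff_le_sum h0 h1 i)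
  have t1 (i : ℕ) := mul_nonneg (hb.nonneg_three_mul_add_one i) (pow_nonneg h0 (3 * i + 1))
  have t2 (i : ℕ) := mul_nonneg (hb.nonneg_three_mul_add_two i) (pow_nonneg h0 (3 * i + 2))
  obtain ⟨i, rfl | rfl | rfl⟩ : ∃ i, n = 3 * i ∨ n = 3 * i + 1 ∨ n = 3 * i + 2 :=
    ⟨n / 3, by omega⟩
  · exact key i
  · rw [sum_range_succ]
    linarith [key i, t1 i]
  · rw [sum_range_succ, sum_range_succ]
    linarith [key i, t1 i, t2 i]

end IsSqrtCoeff

open PowerSeries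

/-- The Taylor series of `√(1 - z)` at `0`. -/
noncomputable def sqrtOneSubSeries : PowerSeries ℝ := PowerSeries.mk e

/-- The truncation of `∑ b k X ^ k` to degree at most `n`. -/
noncomputable def truncSeries (b : ℕ → ℝ) (n : ℕ) : PowerSeries ℝ :=
  ∑ k ∈ range (n + 1), C (b k) * X ^ k

theorem coeff_truncSeries (b : ℕ → ℝ) (n k : ℕ) :
    coeff k (truncSeries b n) = if k ≤ n then b k else 0 := by
  simp [truncSeries, coeff_X_pow]

theorem truncSeries_succ (b : ℕ → ℝ) (n : ℕ) :
    truncSeries b (n + 1) = truncSeries b n + C (b (n + 1)) * X ^ (n + 1) :=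
  sum_range_succ _ _

theorem derivative_sqrtOneSubSeries :
    2 * (1 - X) * d⁄dX ℝ sqrtOneSubSeries = -sqrtOneSubSeries := by
  ext k
  have := sqrtOneSubCoeff_succ k
  have h2 : (2 : PowerSeries ℝ) = C 2 := (map_ofNat C 2).symm
  rw [mul_assoc, h2, coeff_C_mul, sub_mul, one_mul, map_sub, map_neg]
  cases k with
  | zero =>
    simp [coeff_derivative, sqrtOneSubSeries] at this ⊢
    linarith
  | succ k =>
    simp [coeff_derivative, sqrtOneSubSeries, coeff_succ_X_mul] at this ⊢
    linarith

theorem IsSqrtCoeff.derivative_truncSeries {b : ℕ → ℝ} (hb : IsSqrtCoeff b) (n : ℕ) :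
    2 * (1 + X + X ^ 2) * d⁄dX ℝ (truncSeries b n) - (2 * X + 1) * truncSeries b n =
      X ^ n * (C (-2 * (n + 1) * b (n + 1)) + C (2 * (n - 1) * b n) * X) := by
  induction n with
  | zero =>
    have h2 : (2 : PowerSeries ℝ) = C 2 := (map_ofNat C 2).symm
    simp [truncSeries, hb.zero, hb.one]
    linear_combination h2
  | succ n ih =>
    have h := congrArg (C : ℝ → PowerSeries ℝ) (hb.recurrence n)
    have h2 : (C (1 / 2 : ℝ) : PowerSeries ℝ) * 2 = 1 := by
      rw [show (2 : PowerSeries ℝ) = C 2 from (map_ofNat C 2).symm, ← map_mul]; norm_num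
    rw [truncSeries_succ]
    simp only [map_add, Derivation.leibniz, derivative_C, smul_eq_mul, Derivation.leibniz_pow,
      derivative_X, map_mul, map_sub, map_neg, map_one, map_ofNat, map_natCast, Nat.cast_add,
      Nat.cast_one, Nat.add_sub_cancel, mul_zero, add_zero, nsmul_eq_mul, add_assoc,
      Nat.reduceAdd] at ih h ⊢
    linear_combination ih + 2 * X ^ (n + 1) * h - X ^ (n + 1) * C (b (n + 1)) * h2

theorem IsSqrtCoeff.derivative_mul {b : ℕ → ℝ} (hb : IsSqrtCoeff b) (n : ℕ) :
    2 * (1 - X ^ 3) * d⁄dX ℝ (truncSeries b n * sqrtOneSubSeries)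
      + 3 * X ^ 2 * (truncSeries b n * sqrtOneSubSeries) =
    X ^ n * (((1 - X) * sqrtOneSubSeries) *
      (C (-2 * (n + 1) * b (n + 1)) + C (2 * (n - 1) * b n) * X)) := by
  rw [Derivation.leibniz, smul_eq_mul, smul_eq_mul]
  linear_combination (1 - X) * sqrtOneSubSeries * hb.derivative_truncSeries n
    + (1 + X + X ^ 2) * truncSeries b n * derivative_sqrtOneSubSeries

theorem coeff_zero_one_sub_mul_sqrtOneSubSeries :
    coeff 0 ((1 - X) * sqrtOneSubSeries) = 1 := by
  simp [sqrtOneSubSeries, sqrtOneSubCoeff_zero]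

theorem coeff_succ_one_sub_mul_sqrtOneSubSeries (m : ℕ) :
    coeff (m + 1) ((1 - X) * sqrtOneSubSeries) = -(3 / 2) * e m / (m + 1) := by
  have := sqrtOneSubCoeff_succ m
  have h : (m : ℝ) + 1 ≠ 0 := by positivity
  rw [sub_mul, one_mul, map_sub, coeff_succ_X_mul, sqrtOneSubSeries, coeff_mk, coeff_mk,
    eq_div_iff h]
  linarith

namespace IsSqrtCoeff

variable {b : ℕ → ℝ}

/-- The recurrence for the coefficients of `truncSeries b n * √(1 - X)`. -/
theorem coeff_recurrence (hb : IsSqrtCoeff b) (n k : ℕ) :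
    2 * (k + 3) * coeff (k + 3) (truncSeries b n * sqrtOneSubSeries) =
      (2 * k - 3) * coeff k (truncSeries b n * sqrtOneSubSeries) +
      coeff (k + 2) (X ^ n * (((1 - X) * sqrtOneSubSeries) *
        (C (-2 * (n + 1) * b (n + 1)) + C (2 * (n - 1) * b n) * X))) := by
  rw [← hb.derivative_mul]
  generalize truncSeries b n * sqrtOneSubSeries = F
  rw [show 2 * (1 - X ^ 3) * d⁄dX ℝ F + 3 * X ^ 2 * F = C 2 * d⁄dX ℝ F
    - C 2 * (X ^ 2 * (X * d⁄dX ℝ F)) + C 3 * (X ^ 2 * F) by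
      simp only [map_ofNat]
      ring]
  rw [map_add, map_sub, coeff_C_mul, coeff_C_mul, coeff_C_mul, coeff_X_pow_mul, coeff_X_pow_mul,
    coeff_derivative]
  have : coeff k (X * d⁄dX ℝ F) = k * coeff k F := by
    cases k with
    | zero => simp
    | succ k => rw [coeff_succ_X_mul, coeff_derivative]; push_cast; ring
  rw [this]
  push_cast
  ring

theorem coeff_one (hb : IsSqrtCoeff b) (n : ℕ) (hn : 1 ≤ n) :
    coeff 1 (truncSeries b n * sqrtOneSubSeries) = 0 := by
  rw [coeff_mul]
  simp [Nat.antidiagonal_succ, coeff_truncSeries, sqrtOneSubSeries, hn, hb.zero, hb.one,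
    sqrtOneSubCoeff_zero, sqrtOneSubCoeff_one]
  norm_num

theorem coeff_two (hb : IsSqrtCoeff b) (n : ℕ) (hn : 2 ≤ n) :
    coeff 2 (truncSeries b n * sqrtOneSubSeries) = 0 := by
  have := sqrtOneSubCoeff_succ 1
  rw [coeff_mul]
  simp [Nat.antidiagonal_succ, coeff_truncSeries, sqrtOneSubSeries, hn, hb.zero, hb.one, hb.two,
    sqrtOneSubCoeff_zero, sqrtOneSubCoeff_one, (by omega : 1 ≤ n)] at this ⊢
  linarith

theorem coeff_zero_eq_one (hb : IsSqrtCoeff b) (n : ℕ) :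
    coeff 0 (truncSeries b n * sqrtOneSubSeries) = 1 := by
  rw [coeff_mul]
  simp [coeff_truncSeries, sqrtOneSubSeries, hb.zero, sqrtOneSubCoeff_zero]

theorem coeff_eq_of_le (hb : IsSqrtCoeff b) (n j : ℕ) :
    (3 * j ≤ n → coeff (3 * j) (truncSeries b n * sqrtOneSubSeries) = e j) ∧
    (3 * j + 1 ≤ n → coeff (3 * j + 1) (truncSeries b n * sqrtOneSubSeries) = 0) ∧
    (3 * j + 2 ≤ n → coeff (3 * j + 2) (truncSeries b n * sqrtOneSubSeries) = 0) := by
  have step (k : ℕ) (hk : k + 3 ≤ n) := hb.coeff_recurrence n k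
  simp only [coeff_X_pow_mul'] at step
  induction j with
  | zero => exact ⟨fun _ => hb.coeff_zero_eq_one n, hb.coeff_one n, hb.coeff_two n⟩
  | succ j ih =>
    obtain ⟨h0, h1, h2⟩ := ih
    have hj : (0 : ℝ) ≤ j := Nat.cast_nonneg j
    refine ⟨fun h => ?_, fun h => ?_, fun h => ?_⟩
    · have := step (3 * j) (by omega)
      rw [if_neg (by omega), h0 (by omega)] at this
      have he := sqrtOneSubCoeff_succ j
      push_cast at this
      rw [show 3 * (j + 1) = 3 * j + 3 by ring]
      refine mul_left_cancel₀ (by positivity : (6 * (j + 1) : ℝ) ≠ 0) ?_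
      linarith
    · have := step (3 * j + 1) (by omega)
      rw [if_neg (by omega), h1 (by omega)] at this
      rw [show 3 * (j + 1) + 1 = 3 * j + 1 + 3 by ring]
      refine mul_left_cancel₀ (by positivity : (2 * ((3 * j + 1 : ℕ) + 3) : ℝ) ≠ 0) ?_
      linarith
    · have := step (3 * j + 2) (by omega)
      rw [if_neg (by omega), h2 (by omega)] at this
      rw [show 3 * (j + 1) + 2 = 3 * j + 2 + 3 by ring]
      refine mul_left_cancel₀ (by positivity : (2 * ((3 * j + 2 : ℕ) + 3) : ℝ) ≠ 0) ?_
      linarith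

theorem coeff_nonpos_of_le (hb : IsSqrtCoeff b) {n k : ℕ} (hk : 1 ≤ k) (hkn : k ≤ n) :
    coeff k (truncSeries b n * sqrtOneSubSeries) ≤ 0 := by
  obtain ⟨j, rfl | rfl | rfl⟩ : ∃ i, k = 3 * i ∨ k = 3 * i + 1 ∨ k = 3 * i + 2 :=
    ⟨k / 3, by omega⟩
  · rw [(hb.coeff_eq_of_le n j).1 hkn]
    obtain ⟨j, rfl⟩ : ∃ i, j = i + 1 := ⟨j - 1, by omega⟩
    exact (sqrtOneSubCoeff_neg j).le
  · exact ((hb.coeff_eq_of_le n j).2.1 hkn).le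
  · exact ((hb.coeff_eq_of_le n j).2.2 hkn).le

theorem coeff_nonpos_three_mul (hb : IsSqrtCoeff b) (i k : ℕ) (hk : 3 * i < k) :
    coeff k (truncSeries b (3 * i) * sqrtOneSubSeries) ≤ 0 := by
  cases i with
  | zero =>
    obtain ⟨k, rfl⟩ : ∃ i, k = i + 1 := ⟨k - 1, by omega⟩
    simp [truncSeries, hb.zero, sqrtOneSubSeries, (sqrtOneSubCoeff_neg k).le]
  | succ i =>
    have step (k : ℕ) := hb.coeff_recurrence (3 * (i + 1)) k
    have hlow := hb.coeff_eq_of_le (3 * (i + 1))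
    generalize truncSeries b (3 * (i + 1)) * sqrtOneSubSeries = F at *
    obtain ⟨hp, hq, hA, hB⟩ := hb.bounds i
    have hi : (0 : ℝ) ≤ i := Nat.cast_nonneg i
    set Q := (1 - X) * sqrtOneSubSeries with hQ
    set R := Q * (C (-2 * ((3 * (i + 1) : ℕ) + 1) * b (3 * (i + 1) + 1)) +
      C (2 * ((3 * (i + 1) : ℕ) - 1) * b (3 * (i + 1))) * X) with hR
    have hR0 : coeff 0 R = -2 * (3 * i + 4) * b (3 * i + 4) := by
      rw [hR, coeff_mul]
      simp [hQ, sqrtOneSubSeries, sqrtOneSubCoeff_zero]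
      ring_nf
    have hRs (m : ℕ) : coeff (m + 1) R = coeff (m + 1) Q * (-2 * (3 * i + 4) * b (3 * i + 4))
        + coeff m Q * (2 * (3 * i + 2) * b (3 * i + 3)) := by
      rw [hR, mul_add, map_add, coeff_mul_C, ← mul_assoc Q, coeff_succ_mul_X, coeff_mul_C]
      push_cast
      ring_nf
    have hQ0 : coeff 0 Q = 1 := coeff_zero_one_sub_mul_sqrtOneSubSeries
    have hQ1 : coeff 1 Q = -(3 / 2) := by
      rw [hQ, coeff_succ_one_sub_mul_sqrtOneSubSeries]; simp [sqrtOneSubCoeff_zero]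
    have hQ2 : coeff 2 Q = 3 / 8 := by
      rw [hQ, coeff_succ_one_sub_mul_sqrtOneSubSeries]; norm_num [sqrtOneSubCoeff_one]
    have hQs (m : ℕ) : 0 ≤ coeff (m + 2) Q := by
      rw [hQ, coeff_succ_one_sub_mul_sqrtOneSubSeries]
      have := sqrtOneSubCoeff_neg m
      exact div_nonneg (by linarith) (by positivity)
    have hL0 : -2 * (3 * i + 4) * b (3 * i + 4) ≤ 0 := by nlinarith
    have hL1 : 2 * (3 * i + 2) * b (3 * i + 3) ≤ 0 := by nlinarith
    obtain ⟨m, rfl⟩ : ∃ m, k = 3 * i + 3 + 1 + m := ⟨k - (3 * i + 4), by omega⟩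
    clear hk
    induction m using Nat.strong_induction_on with
    | _ m ih =>
    have hs := step (3 * i + 1 + m)
    rw [show 3 * i + 1 + m + 2 = m + 3 * (i + 1) by ring, coeff_X_pow_mul,
      show 3 * i + 1 + m + 3 = 3 * i + 3 + 1 + m by ring] at hs
    have hpos : (0 : ℝ) < 2 * ((3 * i + 1 + m : ℕ) + 3) := by positivity
    refine nonpos_of_mul_nonpos_right (b := coeff (3 * i + 3 + 1 + m) F) ?_ hpos
    rw [hs]
    match m with
    | 0 =>
      rw [(hlow i).2.1 (by omega), hR0]
      linarith
    | 1 =>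
      rw [(hlow i).2.2 (by omega), hRs, hQ1, hQ0]
      linarith
    | 2 =>
      have h := (hlow (i + 1)).1 le_rfl
      rw [show 3 * i + 1 + 2 = 3 * (i + 1) by ring, h, hRs, hQ2, hQ1]
      push_cast
      linarith
    | m + 3 =>
      have h1 := ih m (by omega)
      rw [show 3 * i + 1 + (m + 3) = 3 * i + 3 + 1 + m by ring, hRs]
      have h2 : (0 : ℝ) ≤ 2 * (3 * i + 3 + 1 + m : ℕ) - 3 := by
        push_cast
        linarith [(Nat.cast_nonneg m : (0 : ℝ) ≤ m)]
      linarith [mul_nonneg h2 (neg_nonneg.2 h1), mul_nonneg (hQs (m + 1)) (neg_nonneg.2 hL0),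
        mul_nonneg (hQs m) (neg_nonneg.2 hL1)]

theorem coeff_nonpos_succ {n : ℕ} (hn : 0 ≤ b (n + 1))
    (h : ∀ k, n < k → coeff k (truncSeries b n * sqrtOneSubSeries) ≤ 0) (k : ℕ) (hk : n + 1 < k) :
    coeff k (truncSeries b (n + 1) * sqrtOneSubSeries) ≤ 0 := by
  obtain ⟨m, rfl⟩ : ∃ m, k = m + 1 + (n + 1) := ⟨k - (n + 2), by omega⟩
  have h1 := h (m + 1 + (n + 1)) (by omega)
  rw [truncSeries_succ, add_mul, map_add, mul_assoc, coeff_C_mul, coeff_X_pow_mul]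
  have := sqrtOneSubCoeff_neg m
  simp only [sqrtOneSubSeries, coeff_mk] at *
  nlinarith

theorem coeff_nonpos (hb : IsSqrtCoeff b) (n k : ℕ) (hk : 1 ≤ k) :
    coeff k (truncSeries b n * sqrtOneSubSeries) ≤ 0 := by
  rcases le_or_gt k n with h | h
  · exact hb.coeff_nonpos_of_le hk h
  have h0 (i : ℕ) := hb.coeff_nonpos_three_mul i
  have h1 (i : ℕ) := coeff_nonpos_succ (hb.nonneg_three_mul_add_one i) (h0 i)
  have h2 (i : ℕ) := coeff_nonpos_succ (hb.nonneg_three_mul_add_two i) (h1 i)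
  obtain ⟨i, rfl | rfl | rfl⟩ : ∃ i, n = 3 * i ∨ n = 3 * i + 1 ∨ n = 3 * i + 2 :=
    ⟨n / 3, by omega⟩
  exacts [h0 i k h, h1 i k h, h2 i k h]

end IsSqrtCoeff

theorem abs_sqrtOneSubCoeff_le_one (m : ℕ) : |e m| ≤ 1 := by
  induction m with
  | zero => simp [sqrtOneSubCoeff_zero]
  | succ m ih =>
    have hm : (0 : ℝ) ≤ m := Nat.cast_nonneg m
    have h : |(m : ℝ) - 1 / 2| ≤ m + 1 := by rw [abs_le]; constructor <;> linarith
    rw [sqrtOneSubCoeff, abs_div, abs_mul, abs_of_pos (by positivity : (0 : ℝ) < m + 1),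
      div_le_one (by positivity)]
    nlinarith [abs_nonneg (e m), abs_nonneg ((m : ℝ) - 1 / 2)]

theorem summable_sqrtOneSubCoeff {z : ℂ} (hz : ‖z‖ < 1) :
    Summable fun k => (e k : ℂ) * z ^ k := by
  refine Summable.of_norm_bounded (summable_geometric_of_lt_one (norm_nonneg z) hz) fun k => ?_
  rw [norm_mul, norm_pow, Complex.norm_real, Real.norm_eq_abs]
  exact mul_le_of_le_one_left (by positivity) (abs_sqrtOneSubCoeff_le_one k)

theorem one_sub_le_of_hasSum_sqrtOneSubCoeff {r s : ℝ} (h0 : 0 ≤ r) (h1 : r ≤ 1)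
    (h : HasSum (fun k => e k * r ^ k) s) : 1 - r ≤ s := by
  refine ge_of_tendsto ((Filter.tendsto_add_atTop_iff_nat 1).2 h.tendsto_sum_nat)
    (Filter.Eventually.of_forall fun N => ?_)
  have hN := sum_sqrtOneSubCoeff_pos N
  rw [sum_range_succ'] at hN ⊢
  have : r * ∑ k ∈ range N, e (k + 1) ≤ ∑ k ∈ range N, e (k + 1) * r ^ (k + 1) := by
    rw [mul_sum]
    refine sum_le_sum fun k _ => ?_
    have := sqrtOneSubCoeff_neg k
    have h2 := mul_le_mul_of_nonneg_left (pow_le_one₀ h0 h1 (n := k)) h0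
    rw [pow_succ']
    nlinarith
  simp only [sqrtOneSubCoeff_zero, pow_zero, mul_one] at *
  nlinarith

theorem hasSum_coeff_mul {u v : PowerSeries ℂ} {x y z : ℂ}
    (hu : HasSum (fun k => coeff k u * z ^ k) x) (hv : HasSum (fun k => coeff k v * z ^ k) y) :
    HasSum (fun k => coeff k (u * v) * z ^ k) (x * y) := by
  have hu' := hu.summable.norm
  have hv' := hv.summable.norm
  have h : (fun k => coeff k (u * v) * z ^ k) = fun k => ∑ p ∈ HasAntidiagonal.antidiagonal k,
      coeff p.1 u * z ^ p.1 * (coeff p.2 v * z ^ p.2) := by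
    ext k
    rw [coeff_mul, sum_mul]
    refine sum_congr rfl fun p hp => ?_
    rw [← mem_antidiagonal.1 hp, pow_add]
    ring
  rw [h, ← hu.tsum_eq, ← hv.tsum_eq, tsum_mul_tsum_eq_tsum_sum_antidiagonal_of_summable_norm hu' hv']
  exact (summable_norm_sum_mul_antidiagonal_of_summable_norm hu' hv').of_norm.hasSum

theorem hasSum_coeff_map_truncSeries (b : ℕ → ℝ) (n : ℕ) (z : ℂ) :
    HasSum (fun k => coeff k ((truncSeries b n).map Complex.ofRealHom) * z ^ k)
      (∑ k ∈ range (n + 1), (b k : ℂ) * z ^ k) := by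
  have h : ∑ k ∈ range (n + 1), (b k : ℂ) * z ^ k =
      ∑ k ∈ range (n + 1), coeff k ((truncSeries b n).map Complex.ofRealHom) * z ^ k :=
    sum_congr rfl fun k hk => by
      rw [coeff_map, coeff_truncSeries, if_pos (by simpa [Nat.lt_succ_iff] using hk)]; rfl
  rw [h]
  refine hasSum_sum_of_ne_finset_zero fun k hk => ?_
  rw [coeff_map, coeff_truncSeries, if_neg (by simpa [Nat.lt_succ_iff] using hk)]
  simp

theorem IsSqrtCoeff.sum_ne_zero {b : ℕ → ℝ} (hb : IsSqrtCoeff b) (n : ℕ) {z : ℂ} (hz : ‖z‖ < 1) :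
    ∑ k ∈ range (n + 1), (b k : ℂ) * z ^ k ≠ 0 := by
  intro h0
  have hF {w : ℂ} (hw : ‖w‖ < 1) :
      HasSum (fun k => ((coeff k (truncSeries b n * sqrtOneSubSeries) : ℝ) : ℂ) * w ^ k)
        ((∑ k ∈ range (n + 1), (b k : ℂ) * w ^ k) * ∑' k, (e k : ℂ) * w ^ k) := by
    have hE : HasSum (fun k => coeff k (sqrtOneSubSeries.map Complex.ofRealHom) * w ^ k)
        (∑' k, (e k : ℂ) * w ^ k) := by
      simpa [sqrtOneSubSeries] using (summable_sqrtOneSubCoeff hw).hasSum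
    have := hasSum_coeff_mul (hasSum_coeff_map_truncSeries b n w) hE
    rw [← map_mul] at this
    simpa only [coeff_map, Complex.ofRealHom_eq_coe] using this
  have hz1 := hF hz
  rw [h0, zero_mul, ← hasSum_nat_add_iff' 1] at hz1
  have hr1 := hF (w := (‖z‖ : ℂ)) (by simpa using hz)
  have hE : HasSum (fun k => e k * ‖z‖ ^ k) (∑' k, e k * ‖z‖ ^ k) := by
    have := summable_sqrtOneSubCoeff (z := (‖z‖ : ℂ)) (by simpa using hz)
    exact Summable.hasSum (by exact_mod_cast this)
  have hEpos := one_sub_le_of_hasSum_sqrtOneSubCoeff (norm_nonneg z) hz.le hE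
  have hTpos := hb.sum_pos (norm_nonneg z) hz.le n
  have hr2 : HasSum (fun k => coeff k (truncSeries b n * sqrtOneSubSeries) * ‖z‖ ^ k)
      ((∑ k ∈ range (n + 1), b k * ‖z‖ ^ k) * ∑' k, e k * ‖z‖ ^ k) := by
    exact_mod_cast hr1
  rw [← hasSum_nat_add_iff' 1] at hr2
  have := hz1.norm_le_of_bounded hr2.neg fun k => by
    rw [norm_mul, norm_pow, Complex.norm_real, Real.norm_eq_abs,
      abs_of_nonpos (hb.coeff_nonpos n _ (by omega)), neg_mul]
  rw [sum_range_one, sum_range_one, hb.coeff_zero_eq_one] at this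
  norm_num at this
  nlinarith

theorem norm_sum_reflect_eq (c : ℕ → ℝ) (n : ℕ) {w : ℂ} (hw : ‖w‖ = 1) :
    ‖∑ k ∈ range (n + 1), (c (n - k) : ℂ) * w ^ k‖ = ‖∑ k ∈ range (n + 1), (c k : ℂ) * w ^ k‖ := by
  have h : ∑ k ∈ range (n + 1), (c (n - k) : ℂ) * w ^ k =
      w ^ n * (starRingEnd ℂ) (∑ k ∈ range (n + 1), (c k : ℂ) * w ^ k) := by
    rw [← sum_range_reflect, map_sum, mul_sum]
    refine sum_congr rfl fun k hk => ?_
    have hk : k ≤ n := by simpa [Nat.lt_succ_iff] using hk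
    have hww : w * (starRingEnd ℂ) w = 1 := by simp [Complex.mul_conj', hw]
    rw [map_mul, map_pow, Complex.conj_ofReal]
    rw [show n + 1 - 1 - k = n - k by omega, show n - (n - k) = k by omega]
    nth_rw 2 [← Nat.sub_add_cancel hk]
    rw [pow_add]
    linear_combination (-(c k : ℂ) * w ^ (n - k)) * (by rw [← mul_pow, hww, one_pow] :
      w ^ k * (starRingEnd ℂ) w ^ k = 1)
  rw [h, norm_mul, norm_pow, hw, one_pow, one_mul, RCLike.norm_conj]

theorem norm_sum_reflect_le_of_closedBall (c : ℕ → ℝ) (n : ℕ)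
    (hc : ∀ w : ℂ, ‖w‖ ≤ 1 → ∑ k ∈ range (n + 1), (c k : ℂ) * w ^ k ≠ 0) {z : ℂ} (hz : ‖z‖ ≤ 1) :
    ‖∑ k ∈ range (n + 1), (c (n - k) : ℂ) * z ^ k‖ ≤ ‖∑ k ∈ range (n + 1), (c k : ℂ) * z ^ k‖ := by
  have hcl : closure (ball (0 : ℂ) 1) = closedBall 0 1 := closure_ball _ one_ne_zero
  have hd : DiffContOnCl ℂ (fun z : ℂ => (∑ k ∈ range (n + 1), (c (n - k) : ℂ) * z ^ k) /
      ∑ k ∈ range (n + 1), (c k : ℂ) * z ^ k) (ball 0 1) := by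
    apply DifferentiableOn.diffContOnCl
    rw [hcl]
    refine DifferentiableOn.div (by fun_prop) (by fun_prop) fun w hw => hc w (by simpa using hw)
  have := Complex.norm_le_of_forall_mem_frontier_norm_le (C := 1) isBounded_ball hd (fun w hw => by
    have hw : ‖w‖ = 1 := by simpa [frontier_ball] using hw
    rw [norm_div, norm_sum_reflect_eq c n hw, div_self]
    exact norm_ne_zero_iff.2 (hc w hw.le)) (z := z) (by rw [hcl]; simpa using hz)
  rwa [norm_div, div_le_one (norm_pos_iff.2 (hc z hz))] at this

theorem norm_sum_reflect_le (c : ℕ → ℝ) (n : ℕ)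
    (hc : ∀ w : ℂ, ‖w‖ < 1 → ∑ k ∈ range (n + 1), (c k : ℂ) * w ^ k ≠ 0) {z : ℂ} (hz : ‖z‖ ≤ 1) :
    ‖∑ k ∈ range (n + 1), (c (n - k) : ℂ) * z ^ k‖ ≤ ‖∑ k ∈ range (n + 1), (c k : ℂ) * z ^ k‖ := by
  let L : ℝ → ℝ := fun r => ‖∑ k ∈ range (n + 1), ((c (n - k) * r ^ (n - k) : ℝ) : ℂ) * z ^ k‖
  let R : ℝ → ℝ := fun r => ‖∑ k ∈ range (n + 1), ((c k * r ^ k : ℝ) : ℂ) * z ^ k‖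
  have hL : Continuous L := by fun_prop
  have hR : Continuous R := by fun_prop
  have hLR : ∀ᶠ r in nhdsWithin (1 : ℝ) (Set.Iio 1), L r ≤ R r := by
    filter_upwards [Ioo_mem_nhdsLT (zero_lt_one' ℝ)] with r hr
    refine norm_sum_reflect_le_of_closedBall (fun k => c k * r ^ k) n (fun w hw => ?_) hz
    have := hc (r * w) (by
      rw [norm_mul, Complex.norm_real, Real.norm_eq_abs, abs_of_pos hr.1]
      nlinarith [hr.1, hr.2, norm_nonneg w])
    simpa [mul_pow, mul_assoc] using this
  have := le_of_tendsto_of_tendsto (hL.tendsto 1 |>.mono_left nhdsWithin_le_nhds)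
    (hR.tendsto 1 |>.mono_left nhdsWithin_le_nhds) hLR
  simpa [L, R] using this

theorem integral_cos_int_mul (m : ℤ) :
    ∫ θ in (0 : ℝ)..2 * Real.pi, Real.cos (m * θ) = if m = 0 then 2 * Real.pi else 0 := by
  split_ifs with h
  · simp [h]
  · have hm : (m : ℝ) ≠ 0 := Int.cast_ne_zero.2 h
    rw [intervalIntegral.integral_comp_mul_left _ hm, integral_cos, mul_zero, Real.sin_zero,
      show (m : ℝ) * (2 * Real.pi) = ((2 * m : ℤ) : ℝ) * Real.pi by push_cast; ring,
      Real.sin_int_mul_pi]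
    simp

theorem norm_sq_sum_circleMap (b : ℕ → ℝ) (n : ℕ) (θ : ℝ) :
    ‖∑ k ∈ range (n + 1), (b k : ℂ) * circleMap 0 1 θ ^ k‖ ^ 2 =
      ∑ j ∈ range (n + 1), ∑ k ∈ range (n + 1),
        b j * b k * Real.cos (((j : ℤ) - (k : ℤ) : ℤ) * θ) := by
  have hw (k : ℕ) : circleMap 0 1 θ ^ k = Complex.exp ((k * θ : ℝ) * Complex.I) := by
    rw [circleMap_zero, Complex.ofReal_one, one_mul, ← Complex.exp_nat_mul]
    push_cast
    ring_nf
  have hre : (∑ k ∈ range (n + 1), (b k : ℂ) * circleMap 0 1 θ ^ k).re =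
      ∑ k ∈ range (n + 1), b k * Real.cos (k * θ) := by
    simp only [hw, Complex.re_sum, Complex.re_ofReal_mul, Complex.exp_ofReal_mul_I_re]
  have him : (∑ k ∈ range (n + 1), (b k : ℂ) * circleMap 0 1 θ ^ k).im =
      ∑ k ∈ range (n + 1), b k * Real.sin (k * θ) := by
    simp only [hw, Complex.im_sum, Complex.im_ofReal_mul, Complex.exp_ofReal_mul_I_im]
  rw [Complex.sq_norm, Complex.normSq_apply, hre, him, sum_mul_sum, sum_mul_sum, ← sum_add_distrib]
  refine sum_congr rfl fun j _ => ?_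
  rw [← sum_add_distrib]
  refine sum_congr rfl fun k _ => ?_
  push_cast
  rw [sub_mul, Real.cos_sub]
  ring

theorem integral_norm_sq_sum_circleMap (b : ℕ → ℝ) (n : ℕ) :
    ∫ θ in (0 : ℝ)..2 * Real.pi, ‖∑ k ∈ range (n + 1), (b k : ℂ) * circleMap 0 1 θ ^ k‖ ^ 2 =
      2 * Real.pi * ∑ k ∈ range (n + 1), b k ^ 2 := by
  simp only [norm_sq_sum_circleMap]
  rw [intervalIntegral.integral_finsetSum fun j _ => Continuous.intervalIntegrable (by fun_prop) _ _,
    mul_sum]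
  refine sum_congr rfl fun j hj => ?_
  rw [intervalIntegral.integral_finsetSum fun j _ => Continuous.intervalIntegrable (by fun_prop) _ _]
  simp only [intervalIntegral.integral_const_mul, integral_cos_int_mul]
  rw [sum_eq_single_of_mem j hj]
  · simp
    ring
  · intro k _ hk
    rw [if_neg (by omega), mul_zero]

theorem hasFPowerSeriesAt_ofScalars {u : PowerSeries ℂ} {f : ℂ → ℂ}
    (h : ∀ᶠ z in nhds 0, HasSum (fun k => coeff k u * z ^ k) (f z)) :
    HasFPowerSeriesAt f (FormalMultilinearSeries.ofScalars ℂ fun k => coeff k u) 0 := by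
  rw [hasFPowerSeriesAt_iff]
  simpa [FormalMultilinearSeries.coeff_ofScalars, mul_comm] using h

theorem powerSeries_eq_of_hasSum {u v : PowerSeries ℂ} {f : ℂ → ℂ}
    (hu : ∀ᶠ z in nhds 0, HasSum (fun k => coeff k u * z ^ k) (f z))
    (hv : ∀ᶠ z in nhds 0, HasSum (fun k => coeff k v * z ^ k) (f z)) : u = v := by
  have := (hasFPowerSeriesAt_ofScalars hu).eq_formalMultilinearSeries
    (hasFPowerSeriesAt_ofScalars hv)
  ext k
  simpa [FormalMultilinearSeries.coeff_ofScalars] using congrArg (fun p => p.coeff k) this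

theorem norm_coeff_le_of_hasSum {u : PowerSeries ℂ} {f : ℂ → ℂ} {g : ℝ → ℝ} {M : ℝ}
    (hu : ∀ᶠ z in nhds 0, HasSum (fun k => coeff k u * z ^ k) (f z))
    (hf : DifferentiableOn ℂ f (closedBall 0 1)) (hg : Continuous g)
    (hfg : ∀ θ, ‖f (circleMap 0 1 θ)‖ ≤ g θ) (hM : ∫ θ in (0 : ℝ)..2 * Real.pi, g θ = 2 * Real.pi * M)
    (n : ℕ) : ‖coeff n u‖ ≤ M := by
  have hd : DiffContOnCl ℂ f (ball 0 (1 : NNReal)) := by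
    apply DifferentiableOn.diffContOnCl
    rwa [NNReal.coe_one, closure_ball _ one_ne_zero]
  have h1 := (hd.hasFPowerSeriesOnBall one_pos).hasFPowerSeriesAt
  have h2 := h1.eq_formalMultilinearSeries (hasFPowerSeriesAt_ofScalars hu)
  have h3 := norm_cauchyPowerSeries_le f 0 ((1 : NNReal) : ℝ) n
  rw [h2, FormalMultilinearSeries.norm_apply_eq_norm_coef, FormalMultilinearSeries.coeff_ofScalars]
    at h3
  refine h3.trans ?_
  have hc : Continuous fun θ => f (circleMap 0 1 θ) :=
    hf.continuousOn.comp_continuous (continuous_circleMap 0 1) fun θ => by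
      simp [circleMap_zero, Complex.norm_exp_ofReal_mul_I]
  have h4 := intervalIntegral.integral_mono_on (μ := MeasureTheory.volume) Real.two_pi_pos.le
    (hc.norm.intervalIntegrable 0 (2 * Real.pi)) (hg.intervalIntegrable _ _) fun θ _ => hfg θ
  rw [hM] at h4
  simp only [NNReal.coe_one, abs_one, inv_one, one_pow, mul_one]
  rw [inv_mul_le_iff₀ Real.two_pi_pos]
  exact h4

theorem mul_self_eq_of_hasSum {b : ℕ → ℝ}
    (hb : ∀ᶠ z : ℂ in nhds 0,
      HasSum (fun k : ℕ => (b k : ℂ) * z ^ k) ((1 + z + z ^ 2) ^ ((1 : ℂ) / 2))) :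
    (PowerSeries.mk fun k => (b k : ℂ)) * (PowerSeries.mk fun k => (b k : ℂ)) = 1 + X + X ^ 2 := by
  refine powerSeries_eq_of_hasSum (f := fun z => 1 + z + z ^ 2) ?_ ?_
  · filter_upwards [hb] with z hz
    have hz' : HasSum (fun k => coeff k (PowerSeries.mk fun k => (b k : ℂ)) * z ^ k)
        ((1 + z + z ^ 2) ^ ((1 : ℂ) / 2)) := by simpa using hz
    have := hasSum_coeff_mul hz' hz'
    rwa [← sq ((1 + z + z ^ 2) ^ _), ← Complex.cpow_nat_mul, Nat.cast_ofNat, mul_one_div_cancel two_ne_zero,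
      Complex.cpow_one] at this
  · filter_upwards with z
    have : ∑ k ∈ range 3, coeff k (1 + X + X ^ 2 : PowerSeries ℂ) * z ^ k = 1 + z + z ^ 2 := by
      simp [sum_range_succ, coeff_X, coeff_X_pow, coeff_one]
    rw [← this]
    refine hasSum_sum_of_ne_finset_zero fun k hk => ?_
    have hk : 3 ≤ k := by simpa using hk
    simp [coeff_X, coeff_X_pow, PowerSeries.coeff_one, show k ≠ 0 by omega,
      show k ≠ 1 by omega, show k ≠ 2 by omega]

theorem isSqrtCoeff_of_hasSum {b : ℕ → ℝ}
    (hb : ∀ᶠ z : ℂ in nhds 0,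
      HasSum (fun k : ℕ => (b k : ℂ) * z ^ k) ((1 + z + z ^ 2) ^ ((1 : ℂ) / 2))) :
    IsSqrtCoeff b := by
  have hB := mul_self_eq_of_hasSum hb
  have h0 : b 0 = 1 := by
    have h := hb.self_of_nhds
    have h' := hasSum_single (f := fun k : ℕ => (b k : ℂ) * 0 ^ k) 0 (by simp +contextual)
    have := h.unique h'
    simp at this
    exact_mod_cast this.symm
  have hode : 2 * (1 + X + X ^ 2) * d⁄dX ℂ (PowerSeries.mk fun k => (b k : ℂ)) =
      (1 + 2 * X) * PowerSeries.mk fun k => (b k : ℂ) := by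
    have hd := congrArg (d⁄dX ℂ) hB
    have hne : (PowerSeries.mk fun k => (b k : ℂ)) ≠ 0 := by
      intro h
      have := congrArg (coeff 0) h
      simp [h0] at this
    generalize (PowerSeries.mk fun k => (b k : ℂ)) = B at *
    refine mul_right_cancel₀ hne ?_
    simp [Derivation.leibniz, Derivation.leibniz_pow] at hd
    linear_combination (1 + X + X ^ 2) * hd - (1 + 2 * X) * hB
  refine ⟨h0, ?_, fun k => ?_⟩
  · have := congrArg (coeff 1) hB
    rw [coeff_mul] at this
    simp [Nat.antidiagonal_succ, h0, PowerSeries.coeff_one, coeff_X_pow] at this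
    have : b 1 + b 1 = 1 := by exact_mod_cast this
    linarith
  · have hexp : C 2 * (d⁄dX ℂ (PowerSeries.mk fun k => (b k : ℂ))
        + X * d⁄dX ℂ (PowerSeries.mk fun k => (b k : ℂ))
        + X * (X * d⁄dX ℂ (PowerSeries.mk fun k => (b k : ℂ)))) =
        (PowerSeries.mk fun k => (b k : ℂ)) + C 2 * (X * (PowerSeries.mk fun k => (b k : ℂ))) := by
      rw [map_ofNat]
      linear_combination hode
    have := congrArg (coeff (R := ℂ) (k + 1)) hexp
    have hX : coeff (R := ℂ) k (X * d⁄dX ℂ (PowerSeries.mk fun k => (b k : ℂ))) = k * b k := by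
      cases k with
      | zero => simp
      | succ k => simp [coeff_succ_X_mul, coeff_derivative]; ring
    simp only [map_add, coeff_C_mul, coeff_succ_X_mul, coeff_derivative, hX, coeff_mk] at this
    have : 2 * (b (k + 2) * ((k + 1 : ℕ) + 1) + b (k + 1) * (k + 1) + k * b k) =
        b (k + 1) + 2 * b k := by exact_mod_cast this
    push_cast at this
    linarith

/-- Modulo `X ^ (n + 3)`, the square of the truncation is `1 + X + X ^ 2`. -/
theorem coeff_mul_truncSeries_sq {b : ℕ → ℝ}
    (hB : (PowerSeries.mk fun k => (b k : ℂ)) * (PowerSeries.mk fun k => (b k : ℂ)) = 1 + X + X ^ 2)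
    (A : PowerSeries ℂ) (n : ℕ) :
    coeff (n + 2) (A * (truncSeries b (n + 2)).map Complex.ofRealHom *
      (truncSeries b (n + 2)).map Complex.ofRealHom) =
      coeff n A + coeff (n + 1) A + coeff (n + 2) A := by
  set T := (truncSeries b (n + 2)).map Complex.ofRealHom with hT
  obtain ⟨D, hD⟩ : X ^ (n + 3) ∣ (PowerSeries.mk fun k => (b k : ℂ)) - T := by
    rw [X_pow_dvd_iff]
    intro m hm
    simp [hT, coeff_truncSeries, show m ≤ n + 2 by omega]
  have h : A * T * T = A + X * A + X * (X * A)
      - X ^ (n + 3) * (D * (A * ((PowerSeries.mk fun k => (b k : ℂ)) + T))) := by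
    linear_combination A * hB - A * ((PowerSeries.mk fun k => (b k : ℂ)) + T) * hD
  rw [h, map_sub, coeff_X_pow_mul', if_neg (by omega), map_add, map_add, coeff_succ_X_mul,
    coeff_succ_X_mul, coeff_succ_X_mul]
  ring

theorem coeff_mul_truncSeries_reflect (b : ℕ → ℝ) (n : ℕ) :
    coeff n ((truncSeries (fun k => b (n - k)) n).map Complex.ofRealHom *
      (truncSeries b n).map Complex.ofRealHom) = ((∑ k ∈ range (n + 1), b k ^ 2 : ℝ) : ℂ) := by
  rw [← map_mul, coeff_map, coeff_mul, Nat.sum_antidiagonal_eq_sum_range_succ_mk,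
    Complex.ofRealHom_eq_coe, ← sum_range_reflect (fun k => b k ^ 2)]
  congr 1
  refine sum_congr rfl fun k hk => ?_
  have hk : k ≤ n := by simpa [Nat.lt_succ_iff] using hk
  simp [coeff_truncSeries, hk, sq]

/-- Let `b` be the Taylor coefficients at `0` of the principal branch
of `√(1+z+z²)`, `T_n(z) = ∑_{k=0}^n b_k z^k`, and `T_n*(z) = ∑_{k=0}^n b_{n-k} z^k`.
For `n ≥ 2` the Blaschke quotient `f = T_n*/T_n` satisfies `|f| ≤ 1` on the open unit
disk, and its Taylor coefficients `a_k` satisfy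
`sup_{z ∈ 𝔻} |a_{n-2} z^{n-2} + a_{n-1} z^{n-1} + a_n z^n| = ∑_{k=0}^n b_k²`. -/
theorem blaschke_quotient_extremal
    (b : ℕ → ℝ)
    (hb : ∀ᶠ z : ℂ in nhds 0,
      HasSum (fun k : ℕ => (b k : ℂ) * z ^ k) ((1 + z + z ^ 2) ^ ((1 : ℂ) / 2)))
    (n : ℕ) (hn : 2 ≤ n)
    (f : ℂ → ℂ)
    (hfdef : ∀ z : ℂ, f z =
      (∑ k ∈ Finset.range (n + 1), (b (n - k) : ℂ) * z ^ k) /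
      (∑ k ∈ Finset.range (n + 1), (b k : ℂ) * z ^ k))
    (a : ℕ → ℂ)
    (ha : ∀ᶠ z : ℂ in nhds 0, HasSum (fun k : ℕ => a k * z ^ k) (f z)) :
    (∀ z ∈ ball (0 : ℂ) 1, ‖f z‖ ≤ 1) ∧
    (⨆ z : ball (0 : ℂ) 1,
        ‖a (n - 2) * (z : ℂ) ^ (n - 2) + a (n - 1) * (z : ℂ) ^ (n - 1) + a n * (z : ℂ) ^ n‖) =
      ∑ k ∈ Finset.range (n + 1), (b k) ^ 2 := by
  have hs := isSqrtCoeff_of_hasSum hb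
  have hB := mul_self_eq_of_hasSum hb
  have hT {z : ℂ} (hz : ‖z‖ < 1) := hs.sum_ne_zero n hz
  have hle : ∀ z ∈ ball (0 : ℂ) 1, ‖f z‖ ≤ 1 := fun z hz => by
    have hz : ‖z‖ < 1 := by simpa using hz
    rw [hfdef, norm_div, div_le_one (norm_pos_iff.2 (hT hz))]
    exact norm_sum_reflect_le b n (fun w hw => hT hw) hz.le
  refine ⟨hle, ?_⟩
  have ha' : ∀ᶠ z : ℂ in nhds 0, HasSum (fun k => coeff k (PowerSeries.mk a) * z ^ k) (f z) := by
    simpa using ha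
  have hmul : PowerSeries.mk a * (truncSeries b n).map Complex.ofRealHom =
      (truncSeries (fun k => b (n - k)) n).map Complex.ofRealHom := by
    refine powerSeries_eq_of_hasSum
      (f := fun z => ∑ k ∈ range (n + 1), (b (n - k) : ℂ) * z ^ k) ?_
      (.of_forall fun z => hasSum_coeff_map_truncSeries _ n z)
    filter_upwards [ha', ball_mem_nhds (0 : ℂ) one_pos] with z hz hz1
    have := hasSum_coeff_mul hz (hasSum_coeff_map_truncSeries b n z)
    rwa [hfdef, div_mul_cancel₀ _ (hT (by simpa using hz1))] at this
  obtain ⟨m, rfl⟩ : ∃ m, n = m + 2 := ⟨n - 2, by omega⟩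
  simp only [show m + 2 - 2 = m by omega, show m + 2 - 1 = m + 1 by omega]
  have hone : a m + a (m + 1) + a (m + 2) = ((∑ k ∈ range (m + 2 + 1), b k ^ 2 : ℝ) : ℂ) := by
    have := coeff_mul_truncSeries_sq hB (PowerSeries.mk a) m
    rw [hmul, coeff_mul_truncSeries_reflect] at this
    simpa using this.symm
  have hupper (z : ball (0 : ℂ) 1) :
      ‖a m * (z : ℂ) ^ m + a (m + 1) * (z : ℂ) ^ (m + 1) + a (m + 2) * (z : ℂ) ^ (m + 2)‖ ≤
        ∑ k ∈ range (m + 2 + 1), b k ^ 2 := by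
    obtain ⟨z, hz⟩ := z
    have hz : ‖z‖ < 1 := by simpa using hz
    have hzw {w : ℂ} (hw : ‖w‖ ≤ 1) : ‖z * w‖ < 1 := by
      rw [norm_mul]
      nlinarith [norm_nonneg z, norm_nonneg w]
    have h := coeff_mul_truncSeries_sq hB (PowerSeries.mk fun k => a k * z ^ k) m
    simp only [coeff_mk] at h
    rw [← h]
    refine norm_coeff_le_of_hasSum
      (f := fun w => f (z * w) * (∑ k ∈ range (m + 2 + 1), (b k : ℂ) * w ^ k) *
        ∑ k ∈ range (m + 2 + 1), (b k : ℂ) * w ^ k)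
      (g := fun θ => ‖∑ k ∈ range (m + 2 + 1), (b k : ℂ) * circleMap 0 1 θ ^ k‖ ^ 2) ?_ ?_ ?_ ?_
      (integral_norm_sq_sum_circleMap b (m + 2)) (m + 2)
    · have ht : Filter.Tendsto (fun w : ℂ => z * w) (nhds 0) (nhds 0) :=
        Continuous.tendsto' (by fun_prop) _ _ (mul_zero z)
      filter_upwards [ht.eventually ha] with w hw
      have hw' : HasSum (fun k => coeff k (PowerSeries.mk fun k => a k * z ^ k) * w ^ k)
          (f (z * w)) := by
        simpa [mul_pow, mul_assoc] using hw
      have hTw := hasSum_coeff_map_truncSeries b (m + 2) w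
      exact hasSum_coeff_mul (hasSum_coeff_mul hw' hTw) hTw
    · simp only [hfdef]
      refine DifferentiableOn.mul (DifferentiableOn.mul (DifferentiableOn.div (by fun_prop)
        (by fun_prop) fun w hw => hT (hzw (by simpa using hw))) (by fun_prop)) (by fun_prop)
    · fun_prop
    · intro θ
      rw [norm_mul, norm_mul, mul_assoc, ← sq]
      refine mul_le_of_le_one_left (sq_nonneg _) (hle _ ?_)
      rw [mem_ball_zero_iff]
      exact hzw (by simp [circleMap_zero, Complex.norm_exp_ofReal_mul_I])
  have : Nonempty (ball (0 : ℂ) 1) := ⟨⟨0, by simp⟩⟩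
  refine le_antisymm (ciSup_le hupper) ?_
  let g : ℝ → ℝ := fun r => ‖a m * (r : ℂ) ^ m + a (m + 1) * (r : ℂ) ^ (m + 1) +
    a (m + 2) * (r : ℂ) ^ (m + 2)‖
  have hg : Continuous g := by fun_prop
  have hg1 : g 1 = ∑ k ∈ range (m + 2 + 1), b k ^ 2 := by
    simp only [g, Complex.ofReal_one, one_pow, mul_one]
    rw [hone, Complex.norm_real, Real.norm_eq_abs, abs_of_nonneg (sum_nonneg fun k _ => sq_nonneg _)]
  rw [← hg1]
  refine le_of_tendsto ((hg.tendsto 1).mono_left (nhdsWithin_le_nhds (s := Set.Iio 1))) ?_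
  filter_upwards [Ioo_mem_nhdsLT (zero_lt_one' ℝ)] with r hr
  exact le_ciSup_of_le ⟨_, Set.forall_mem_range.2 hupper⟩
    ⟨(r : ℂ), by simp [abs_of_pos hr.1, hr.2]⟩ le_rfl
end

section
/- Suppose k ≥ 1 and 0 < b_k < b_{k+1}. Then b_{k+2} < 0 < b_{k+3} < b_{k+4}. -/
open Finset

/-- Complex power series that sum to the same function near `0` have the same coefficients. -/
theorem coeff_eq_of_eventually_hasSum {a c : ℕ → ℂ} {f : ℂ → ℂ}
    (ha : ∀ᶠ z in nhds 0, HasSum (fun n => a n * z ^ n) (f z))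
    (hc : ∀ᶠ z in nhds 0, HasSum (fun n => c n * z ^ n) (f z)) : a = c := by
  have key : ∀ d : ℕ → ℂ, (∀ᶠ z in nhds 0, HasSum (fun n => d n * z ^ n) (f z)) →
      HasFPowerSeriesAt f (FormalMultilinearSeries.ofScalars ℂ d) 0 := by
    intro d hd
    rw [hasFPowerSeriesAt_iff]
    filter_upwards [hd] with z hz
    simpa [FormalMultilinearSeries.coeff_ofScalars, mul_comm] using hz
  have h := (key a ha).eq_formalMultilinearSeries (key c hc)
  ext n
  simpa [FormalMultilinearSeries.coeff_ofScalars] using congrArg (fun p => p.coeff n) h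

/-- Coefficients of a square root of `1 + z + z²` square to `1 + X + X²` as a formal power series. -/
theorem mk_sq_eq_of_hasSum_sqrt {b : ℕ → ℝ}
    (hb : ∀ᶠ z : ℂ in nhds 0,
      HasSum (fun k : ℕ => (b k : ℂ) * z ^ k) ((1 + z + z ^ 2) ^ ((1 : ℂ) / 2))) :
    PowerSeries.mk b ^ 2 = 1 + PowerSeries.X + PowerSeries.X ^ 2 := by
  have hsq : ∀ᶠ z : ℂ in nhds 0, HasSum
      (fun n => ((PowerSeries.coeff n (PowerSeries.mk b ^ 2) : ℝ) : ℂ) * z ^ n) (1 + z + z ^ 2) := by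
    filter_upwards [hb] with z hz
    have hn := hz.summable.norm
    have hprod := (summable_norm_sum_mul_antidiagonal_of_summable_norm hn hn).of_norm.hasSum
    rw [← tsum_mul_tsum_eq_tsum_sum_antidiagonal_of_summable_norm hn hn, hz.tsum_eq, ← sq,
      one_div, show (2 : ℂ)⁻¹ = ((2 : ℕ) : ℂ)⁻¹ by norm_num,
      Complex.cpow_nat_inv_pow _ two_ne_zero] at hprod
    refine hprod.congr_fun fun n => ?_
    rw [sq, PowerSeries.coeff_mul]
    push_cast
    rw [sum_mul]
    refine sum_congr rfl fun p hp => ?_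
    rw [← mem_antidiagonal.mp hp, pow_add, PowerSeries.coeff_mk, PowerSeries.coeff_mk]
    ring
  have hpoly : ∀ᶠ z : ℂ in nhds 0, HasSum
      (fun n => ((PowerSeries.coeff n (1 + PowerSeries.X + PowerSeries.X ^ 2) : ℝ) : ℂ) * z ^ n) (1 + z + z ^ 2) := by
    refine Filter.Eventually.of_forall fun z => ?_
    convert hasSum_sum_of_ne_finset_zero (s := range 3) (L := .unconditional ℕ) ?_ using 1
    · simp [sum_range_succ, PowerSeries.coeff_one, PowerSeries.coeff_X, PowerSeries.coeff_X_pow]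
    · intro n hn
      have : 3 ≤ n := by simpa using hn
      simp [PowerSeries.coeff_one, PowerSeries.coeff_X, PowerSeries.coeff_X_pow,
        show n ≠ 0 by omega, show n ≠ 1 by omega, show n ≠ 2 by omega]
  ext n
  exact_mod_cast congrFun (coeff_eq_of_eventually_hasSum hsq hpoly) n

/-- The three-term recurrence satisfied by the coefficients of a square root of `1 + X + X²`. -/
theorem recurrence_of_mk_sq_eq {b : ℕ → ℝ}
    (h : PowerSeries.mk b ^ 2 = 1 + PowerSeries.X + PowerSeries.X ^ 2) (k : ℕ) :
    2 * ((k : ℝ) + 2) * b (k + 2) = -(2 * k + 1) * b (k + 1) - (2 * k - 2) * b k := by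
  set B := PowerSeries.mk b with hB
  have hd := congrArg (PowerSeries.derivative ℝ) h
  simp only [sq, Derivation.leibniz, map_add, PowerSeries.derivative_X, smul_eq_mul,
    Derivation.map_one_eq_zero] at hd
  set D := PowerSeries.derivative ℝ B with hD
  have hode : 2 * (D + PowerSeries.X * D + PowerSeries.X * (PowerSeries.X * D))
      = B + 2 * (PowerSeries.X * B) := by
    linear_combination B * hd - 2 * D * h
  have hc := congrArg (PowerSeries.coeff (k + 1)) hode
  cases k with
  | zero =>
    simp [two_mul, PowerSeries.coeff_succ_X_mul, hD, hB, PowerSeries.coeff_derivative] at hc ⊢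
    linarith
  | succ k =>
    simp [two_mul, PowerSeries.coeff_succ_X_mul, hD, hB, PowerSeries.coeff_derivative] at hc ⊢
    linarith

/-- Let `b_k` be the Taylor coefficients of the principal branch of
`√(1+z+z²)`. If `k ≥ 1` and `0 < b_k < b_{k+1}`, then `b_{k+2} < 0 < b_{k+3} < b_{k+4}`. -/
theorem coeff_sign_step
    (b : ℕ → ℝ)
    (hb : ∀ᶠ z : ℂ in nhds 0,
      HasSum (fun k : ℕ => (b k : ℂ) * z ^ k) ((1 + z + z ^ 2) ^ ((1 : ℂ) / 2)))
    (k : ℕ) (hk : 1 ≤ k) (h0 : 0 < b k) (h1 : b k < b (k + 1)) :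
    b (k + 2) < 0 ∧ 0 < b (k + 3) ∧ b (k + 3) < b (k + 4) := by
  have hrec := recurrence_of_mk_sq_eq (mk_sq_eq_of_hasSum_sqrt hb)
  have r2 := hrec k
  have r3 := hrec (k + 1)
  have r4 := hrec (k + 2)
  simp only [add_assoc, Nat.reduceAdd] at r3 r4
  push_cast at r3 r4
  obtain ⟨t, ht, hkt⟩ : ∃ t : ℝ, 0 ≤ t ∧ (k : ℝ) = t + 1 :=
    ⟨k - 1, by simpa using (Nat.one_le_cast (α := ℝ)).mpr hk, by ring⟩
  rw [hkt] at r2 r3 r4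
  generalize b k = x at *
  obtain ⟨e, he, hy⟩ : ∃ e : ℝ, 0 < e ∧ b (k + 1) = x + e :=
    ⟨b (k + 1) - x, sub_pos.mpr h1, by ring⟩
  rw [hy] at r2 r3
  have e3 : 4 * (t + 3) * (t + 4) * b (k + 3) = 3 * (x + e) + (2 * t + 5) * (2 * t) * x := by
    linear_combination 2 * (t + 3) * r3 - (2 * t + 5) * r2
  have e4 : 8 * (t + 3) * (t + 4) * (t + 5) * (b (k + 4) - b (k + 3)) =
      (18 * t + 45) * x + (8 * t ^ 3 + 60 * t ^ 2 + 124 * t + 45) * e := by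
    linear_combination 4 * (t + 3) * (t + 4) * r4 - (4 * t + 17) * e3
      - 4 * (t + 2) * (t + 4) * r2
  refine ⟨?_, ?_, ?_⟩
  · have : 0 < 2 * (t + 3) * -b (k + 2) := by
      have : 0 < (2 * t + 3) * (x + e) + 2 * t * x := by positivity
      linarith
    exact neg_pos.mp (pos_of_mul_pos_right this (by positivity))
  · have : 0 < 4 * (t + 3) * (t + 4) * b (k + 3) := by rw [e3]; positivity
    exact pos_of_mul_pos_right this (by positivity)
  · have : 0 < 8 * (t + 3) * (t + 4) * (t + 5) * (b (k + 4) - b (k + 3)) := by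
      rw [e4]; positivity
    exact sub_pos.mp (pos_of_mul_pos_right this (by positivity))
end
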